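/- arXiv:2411.02813 — 3 statements merged into one kernel-verified Lean document; each statement's English description precedes it below -/
import Mathlib

section
/- Let n ≥ 1, let w : Fin n → ℝ be strictly positive weights, and let δmin, δmax be real numbers with -1 < δmin ≤ δmax. Suppose c : Fin n → ℝ satisfies 1 + δmin ≤ c j ≤ 1 + δmax for all j. Define the normalized weights A j = w j / (∑ k, w k) and the perturbed normalized weights Â j = (c j * w j) / (∑ k, c k * w k). Then for every j, ((1 + δmin)/(1 + δmax)) * A j ≤ Â j ≤ ((1 + δmax)/(1 + δmin)) * A j. -/
open Finset

theorem sotu_perturbed_normalized_weights_bound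
    (n : ℕ) (hn : 1 ≤ n) (w : Fin n → ℝ) (hw : ∀ j, 0 < w j)
    (δmin δmax : ℝ) (hδ : -1 < δmin) (hδ' : δmin ≤ δmax)
    (c : Fin n → ℝ) (hc : ∀ j, 1 + δmin ≤ c j ∧ c j ≤ 1 + δmax)
    (A Ahat : Fin n → ℝ)
    (hA : ∀ j, A j = w j / ∑ k, w k)
    (hAhat : ∀ j, Ahat j = (c j * w j) / ∑ k, c k * w k) :
    ∀ j, ((1 + δmin) / (1 + δmax)) * A j ≤ Ahat j ∧
      Ahat j ≤ ((1 + δmax) / (1 + δmin)) * A j := by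
  intro j
  have hmin : 0 < 1 + δmin := by linarith
  have hmax : 0 < 1 + δmax := by linarith
  have hS : 0 < ∑ k, w k := sum_pos (fun k _ => hw k) ⟨j, mem_univ j⟩
  have hlower : (1 + δmin) * ∑ k, w k ≤ ∑ k, c k * w k := by
    rw [mul_sum]
    exact sum_le_sum fun k _ => mul_le_mul_of_nonneg_right (hc k).1 (hw k).le
  have hupper : ∑ k, c k * w k ≤ (1 + δmax) * ∑ k, w k := by
    rw [mul_sum]
    exact sum_le_sum fun k _ => mul_le_mul_of_nonneg_right (hc k).2 (hw k).le
  have hlower_pos : 0 < (1 + δmin) * ∑ k, w k := mul_pos hmin hS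
  rw [hA, hAhat, div_mul_div_comm, div_mul_div_comm]
  constructor
  · exact div_le_div₀ (mul_pos (hmin.trans_le (hc j).1) (hw j)).le
      (mul_le_mul_of_nonneg_right (hc j).1 (hw j).le) (hlower_pos.trans_le hlower) hupper
  · exact div_le_div₀ (mul_pos hmax (hw j)).le
      (mul_le_mul_of_nonneg_right (hc j).2 (hw j).le) hlower_pos hlower
end

section
/- Let n ≥ 1 and let s, ŝ : Fin n → ℝ be score vectors. Let δmin, δmax be real numbers with -1 < δmin ≤ δmax, and suppose 1 + δmin ≤ Real.exp (ŝ j - s j) ≤ 1 + δmax for all j. Define the softmax values A j = exp(s j) / (∑ k, exp(s k)) and Â j = exp(ŝ j) / (∑ k, exp(ŝ k)). Then for every j, ((1 + δmin)/(1 + δmax)) * A j ≤ Â j ≤ ((1 + δmax)/(1 + δmin)) * A j. -/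
open Finset

theorem sotu_perturbed_softmax_bound
    (n : ℕ) (hn : 1 ≤ n) (s shat : Fin n → ℝ)
    (δmin δmax : ℝ) (hδ : -1 < δmin) (hδ' : δmin ≤ δmax)
    (hpert : ∀ j, 1 + δmin ≤ Real.exp (shat j - s j) ∧
      Real.exp (shat j - s j) ≤ 1 + δmax)
    (A Ahat : Fin n → ℝ)
    (hA : ∀ j, A j = Real.exp (s j) / ∑ k, Real.exp (s k))
    (hAhat : ∀ j, Ahat j = Real.exp (shat j) / ∑ k, Real.exp (shat k)) :
    ∀ j, ((1 + δmin) / (1 + δmax)) * A j ≤ Ahat j ∧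
      Ahat j ≤ ((1 + δmax) / (1 + δmin)) * A j := by
  intro j
  have hlo : ∀ k, (1 + δmin) * Real.exp (s k) ≤ Real.exp (shat k) := fun k => by
    rw [← le_div_iff₀ (Real.exp_pos _), ← Real.exp_sub]
    exact (hpert k).1
  have hhi : ∀ k, Real.exp (shat k) ≤ (1 + δmax) * Real.exp (s k) := fun k => by
    rw [← div_le_iff₀ (Real.exp_pos _), ← Real.exp_sub]
    exact (hpert k).2
  have hsum_lo : (1 + δmin) * ∑ k, Real.exp (s k) ≤ ∑ k, Real.exp (shat k) := by
    rw [mul_sum]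
    exact sum_le_sum fun k _ => hlo k
  have hsum_hi : ∑ k, Real.exp (shat k) ≤ (1 + δmax) * ∑ k, Real.exp (s k) := by
    rw [mul_sum]
    exact sum_le_sum fun k _ => hhi k
  have hmin : 0 < 1 + δmin := by linarith
  have hS : 0 < ∑ k, Real.exp (s k) := sum_pos (fun k _ => Real.exp_pos _) ⟨j, mem_univ j⟩
  have hShat : 0 < ∑ k, Real.exp (shat k) :=
    sum_pos (fun k _ => Real.exp_pos _) ⟨j, mem_univ j⟩
  rw [hA, hAhat, div_mul_div_comm, div_mul_div_comm]
  exact ⟨div_le_div₀ (Real.exp_pos _).le (hlo j) hShat hsum_hi,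
    div_le_div₀ ((Real.exp_pos _).le.trans (hhi j)) (hhi j) (mul_pos hmin hS) hsum_lo⟩
end

section
/- Let n ≥ 1, let s, ŝ : Fin n → ℝ be score vectors, and let δ ≥ 0 be such that |ŝ j - s j| ≤ δ for all j. Define the softmax values A j = exp(s j) / (∑ k, exp(s k)) and Â j = exp(ŝ j) / (∑ k, exp(ŝ k)). Then for every j, Real.exp (-2*δ) * A j ≤ Â j ≤ Real.exp (2*δ) * A j. -/
open Finset

/-- If two score vectors differ by at most `δ` entrywise, their softmax entries differ by a factor
of at most `exp (2 * δ)`. -/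
lemma softmax_le_exp_two_mul_softmax {ι : Type*} [Fintype ι] {s t : ι → ℝ} {δ : ℝ}
    (h : ∀ j, |t j - s j| ≤ δ) (j : ι) :
    Real.exp (t j) / ∑ k, Real.exp (t k) ≤
      Real.exp (2 * δ) * (Real.exp (s j) / ∑ k, Real.exp (s k)) := by
  have hs : 0 < ∑ k, Real.exp (s k) := sum_pos (fun k _ => Real.exp_pos _) ⟨j, mem_univ j⟩
  have ht : 0 < ∑ k, Real.exp (t k) := sum_pos (fun k _ => Real.exp_pos _) ⟨j, mem_univ j⟩
  have hnum : Real.exp (t j) ≤ Real.exp δ * Real.exp (s j) := by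
    rw [← Real.exp_add, Real.exp_le_exp]
    linarith [(abs_le.mp (h j)).2]
  have hden : ∑ k, Real.exp (s k) ≤ Real.exp δ * ∑ k, Real.exp (t k) := by
    rw [mul_sum]
    refine sum_le_sum fun k _ => ?_
    rw [← Real.exp_add, Real.exp_le_exp]
    linarith [(abs_le.mp (h k)).1]
  rw [← mul_div_assoc, div_le_div_iff₀ ht hs]
  calc Real.exp (t j) * ∑ k, Real.exp (s k)
      ≤ (Real.exp δ * Real.exp (s j)) * (Real.exp δ * ∑ k, Real.exp (t k)) := by gcongr
    _ = Real.exp (2 * δ) * Real.exp (s j) * ∑ k, Real.exp (t k) := by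
      rw [two_mul, Real.exp_add]
      ring

theorem sotu_softmax_small_perturbation_bound
    (n : ℕ) (hn : 1 ≤ n) (s shat : Fin n → ℝ)
    (δ : ℝ) (hδ : 0 ≤ δ) (hpert : ∀ j, |shat j - s j| ≤ δ)
    (A Ahat : Fin n → ℝ)
    (hA : ∀ j, A j = Real.exp (s j) / ∑ k, Real.exp (s k))
    (hAhat : ∀ j, Ahat j = Real.exp (shat j) / ∑ k, Real.exp (shat k)) :
    ∀ j, Real.exp (-2 * δ) * A j ≤ Ahat j ∧ Ahat j ≤ Real.exp (2 * δ) * A j := by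
  intro j
  rw [hA, hAhat]
  refine ⟨?_, softmax_le_exp_two_mul_softmax hpert j⟩
  rw [neg_mul, Real.exp_neg, inv_mul_le_iff₀ (Real.exp_pos _)]
  exact softmax_le_exp_two_mul_softmax (fun k => abs_sub_comm (s k) (shat k) ▸ hpert k) j
end
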